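/- Gaussian complexity bound for the partially penalized error cone: Let f and g be norms on ℝ^n and ℝ^m, x* ∈ ℝ^n, v* ∈ ℝ^m, λ₁, λ₂ > 0 with λ = λ₂/λ₁, and let C₂(x*,v*) := {(a,b) ∈ ℝ^n × ℝ^m : ⟨a,u⟩ + λ⟨b,s⟩ ≤ 0 for all u ∈ ∂f(x*) and all s ∈ ∂g(v*)}. Then γ(C₂(x*,v*) ∩ S^{n+m−1}) ≤ 2 √( η²(λ₁·∂f(x*)) + η²(λ₂·∂g(v*)) ) + 1. -/

import Mathlib

open MeasureTheory ProbabilityTheory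

noncomputable section

/-- Squared Euclidean norm of a vector in `ι → ℝ`. -/
def sqNorm {ι : Type*} [Fintype ι] (x : ι → ℝ) : ℝ := ∑ i, (x i) ^ 2

/-- Euclidean norm of a vector in `ι → ℝ`. -/
def eNorm {ι : Type*} [Fintype ι] (x : ι → ℝ) : ℝ := Real.sqrt (sqNorm x)

/-- Euclidean inner product. -/
def dotp {ι : Type*} [Fintype ι] (x y : ι → ℝ) : ℝ := ∑ i, x i * y i

/-- Sub-Gaussian (ψ₂, Orlicz) norm of a real random variable. -/
def psi2Norm {Ω : Type*} [MeasurableSpace Ω] (μ : Measure Ω) (X : Ω → ℝ) : ℝ :=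
  sInf {K : ℝ | 0 < K ∧ ∫ ω, Real.exp ((X ω) ^ 2 / K ^ 2) ∂μ ≤ 2}

/-- Sub-Gaussian (ψ₂) norm of a random vector: supremum of ψ₂ norms of its
one-dimensional marginals over the unit sphere. -/
def vecPsi2Norm {Ω : Type*} [MeasurableSpace Ω] {ι : Type*} [Fintype ι]
    (μ : Measure Ω) (X : Ω → ι → ℝ) : ℝ :=
  sSup {c : ℝ | ∃ y : ι → ℝ, sqNorm y = 1 ∧ c = psi2Norm μ (fun ω => dotp (X ω) y)}

/-- A random vector is centered if each coordinate has zero mean. -/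
def IsCentered {Ω : Type*} [MeasurableSpace Ω] {ι : Type*} [Fintype ι]
    (μ : Measure Ω) (X : Ω → ι → ℝ) : Prop :=
  ∀ i, ∫ ω, X ω i ∂μ = 0

/-- A random vector is isotropic if its second moment matrix is the identity. -/
def IsIsotropic {Ω : Type*} [MeasurableSpace Ω] {ι : Type*} [Fintype ι] [DecidableEq ι]
    (μ : Measure Ω) (X : Ω → ι → ℝ) : Prop :=
  ∀ i j, ∫ ω, X ω i * X ω j ∂μ = if i = j then (1 : ℝ) else 0

/-- Standard Gaussian measure on `ι → ℝ`. -/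
def stdGaussian (ι : Type*) [Fintype ι] : Measure (ι → ℝ) :=
  Measure.pi fun _ => gaussianReal 0 1

/-- Gaussian complexity `γ(T) = E sup_{x ∈ T} |⟨g, x⟩|`. -/
def gaussComplexity {ι : Type*} [Fintype ι] (T : Set (ι → ℝ)) : ℝ :=
  ∫ g, sSup ((fun x => |dotp g x|) '' T) ∂(stdGaussian ι)

/-- Gaussian width `ω(T) = E sup_{x ∈ T} ⟨g, x⟩`. -/
def gaussWidth {ι : Type*} [Fintype ι] (T : Set (ι → ℝ)) : ℝ :=
  ∫ g, sSup ((fun x => dotp g x) '' T) ∂(stdGaussian ι)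

/-- Gaussian squared distance `η²(T) = E inf_{u ∈ T} ‖g - u‖₂²`. -/
def gaussSqDist {ι : Type*} [Fintype ι] (T : Set (ι → ℝ)) : ℝ :=
  ∫ g, sInf ((fun u => sqNorm (g - u)) '' T) ∂(stdGaussian ι)

/-- Radius `rad(T) = sup_{x ∈ T} ‖x‖₂`. -/
def radius {ι : Type*} [Fintype ι] (T : Set (ι → ℝ)) : ℝ :=
  sSup (eNorm '' T)

/-- Euclidean boundedness of a set. -/
def EBounded {ι : Type*} [Fintype ι] (T : Set (ι → ℝ)) : Prop :=
  ∃ R : ℝ, ∀ x ∈ T, eNorm x ≤ R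

/-- Unit Euclidean sphere in `ι → ℝ`. -/
def unitSphere (ι : Type*) [Fintype ι] : Set (ι → ℝ) := {x | sqNorm x = 1}

/-- Identify a pair `(a, b) ∈ ℝ^n × ℝ^m` with the concatenated vector in `ℝ^{n+m}`. -/
def pairVec {n m : ℕ} (p : (Fin n → ℝ) × (Fin m → ℝ)) : (Fin n ⊕ Fin m) → ℝ :=
  Sum.elim p.1 p.2

/-- Image of a set of pairs under concatenation. -/
def pairSet {n m : ℕ} (T : Set ((Fin n → ℝ) × (Fin m → ℝ))) : Set ((Fin n ⊕ Fin m) → ℝ) :=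
  pairVec '' T

/-- Intersection of a set of pairs (viewed in `ℝ^{n+m}`) with the unit sphere. -/
def sphPair {n m : ℕ} (T : Set ((Fin n → ℝ) × (Fin m → ℝ))) : Set ((Fin n ⊕ Fin m) → ℝ) :=
  pairSet T ∩ unitSphere (Fin n ⊕ Fin m)

/-- The extended map `(a, b) ↦ A a + √m · b`. -/
def extMap {m n : ℕ} (A : Matrix (Fin m) (Fin n) ℝ) (p : (Fin n → ℝ) × (Fin m → ℝ)) :
    Fin m → ℝ :=
  A.mulVec p.1 + Real.sqrt m • p.2

/-- Euclidean norm of a pair, `√(‖a‖₂² + ‖b‖₂²)`. -/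
def pairNorm {n m : ℕ} (p : (Fin n → ℝ) × (Fin m → ℝ)) : ℝ :=
  Real.sqrt (sqNorm p.1 + sqNorm p.2)

/-- `f` is a norm on `ι → ℝ`. -/
structure IsNorm {ι : Type*} [Fintype ι] (f : (ι → ℝ) → ℝ) : Prop where
  eq_zero_iff : ∀ x, f x = 0 ↔ x = 0
  smul : ∀ (c : ℝ) (x), f (c • x) = |c| * f x
  triangle : ∀ x y, f (x + y) ≤ f x + f y

/-- Tangent cone (cone of descent directions) of `f` at `x`. -/
def tangentCone' {ι : Type*} [Fintype ι] (f : (ι → ℝ) → ℝ) (x : ι → ℝ) : Set (ι → ℝ) :=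
  {u | ∃ t : ℝ, 0 < t ∧ f (x + t • u) ≤ f x}

/-- Subdifferential of `f` at `x`. -/
def subdiff {ι : Type*} [Fintype ι] (f : (ι → ℝ) → ℝ) (x : ι → ℝ) : Set (ι → ℝ) :=
  {u | ∀ d, f x + dotp u d ≤ f (x + d)}

/-- Dual norm `f*(d) = sup {⟨u, d⟩ : f(u) ≤ 1}`. -/
def dualNorm {ι : Type*} [Fintype ι] (f : (ι → ℝ) → ℝ) (d : ι → ℝ) : ℝ :=
  sSup ((fun u => dotp u d) '' {u | f u ≤ 1})

/-- Compatibility constant `α_f = sup_{u ≠ 0} f(u)/‖u‖₂`. -/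
def compatConst {ι : Type*} [Fintype ι] (f : (ι → ℝ) → ℝ) : ℝ :=
  sSup ((fun u => f u / eNorm u) '' {u | u ≠ 0})

end

noncomputable section

/-- Operator (ℓ₂ → ℓ₂) norm of a square matrix. -/
def opNorm {n : ℕ} (M : Matrix (Fin n) (Fin n) ℝ) : ℝ :=
  sSup ((fun x => eNorm (M.mulVec x)) '' {x : Fin n → ℝ | eNorm x ≤ 1})

end

/-- Squared Euclidean distance from `x` to the set `T`. -/
noncomputable def sqDistTo {ι : Type*} [Fintype ι] (T : Set (ι → ℝ)) (x : ι → ℝ) : ℝ :=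
  sInf ((fun u => sqNorm (x - u)) '' T)

section SquaredDistance

variable {ι : Type*} [Fintype ι]

lemma sqNorm_nonneg (x : ι → ℝ) : 0 ≤ sqNorm x :=
  Finset.sum_nonneg fun _ _ => sq_nonneg _

lemma dotp_sq_le (x y : ι → ℝ) : dotp x y ^ 2 ≤ sqNorm x * sqNorm y :=
  Finset.sum_mul_sq_le_sq_mul_sq _ _ _

lemma bddBelow_sqNorm_sub (T : Set (ι → ℝ)) (x : ι → ℝ) :
    BddBelow ((fun u => sqNorm (x - u)) '' T) :=
  ⟨0, by rintro _ ⟨u, -, rfl⟩; exact sqNorm_nonneg _⟩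

lemma sqDistTo_nonneg (T : Set (ι → ℝ)) (x : ι → ℝ) : 0 ≤ sqDistTo T x :=
  Real.sInf_nonneg (by rintro _ ⟨u, -, rfl⟩; exact sqNorm_nonneg _)

lemma sqDistTo_le {T : Set (ι → ℝ)} {u : ι → ℝ} (hu : u ∈ T) (x : ι → ℝ) :
    sqDistTo T x ≤ sqNorm (x - u) :=
  csInf_le (bddBelow_sqNorm_sub T x) ⟨u, hu, rfl⟩

lemma measurable_sqDistTo (T : Set (ι → ℝ)) : Measurable (sqDistTo T) := by
  have h : sqDistTo T = fun x => ⨅ u : T, sqNorm (x - (u : ι → ℝ)) := by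
    funext x
    rw [sqDistTo, sInf_image']
  rw [h]
  refine (upperSemicontinuous_ciInf (fun x => ?_) fun u => ?_).measurable
  · exact ⟨0, by rintro _ ⟨u, rfl⟩; exact sqNorm_nonneg _⟩
  · refine Continuous.upperSemicontinuous ?_
    unfold sqNorm
    fun_prop

end SquaredDistance

section StandardGaussian

variable {ι : Type*} [Fintype ι]

instance : IsProbabilityMeasure (stdGaussian ι) := by
  unfold _root_.stdGaussian
  infer_instance

lemma measurePreserving_neg_stdGaussian :
    MeasurePreserving (fun x : ι → ℝ => -x) (stdGaussian ι) (stdGaussian ι) :=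
  measurePreserving_pi _ _ fun _ =>
    ⟨measurable_neg, gaussianReal_map_neg.trans (by rw [neg_zero])⟩

lemma measurePreserving_inl_stdGaussian {κ : Type*} [Fintype κ] :
    MeasurePreserving (fun x : ι ⊕ κ → ℝ => fun i => x (Sum.inl i))
      (stdGaussian (ι ⊕ κ)) (stdGaussian ι) :=
  (measurePreserving_fst (μ := stdGaussian ι) (ν := stdGaussian κ)).comp
    (measurePreserving_sumPiEquivProdPi fun _ : ι ⊕ κ => gaussianReal 0 1)

lemma measurePreserving_inr_stdGaussian {κ : Type*} [Fintype κ] :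
    MeasurePreserving (fun x : ι ⊕ κ → ℝ => fun i => x (Sum.inr i))
      (stdGaussian (ι ⊕ κ)) (stdGaussian κ) :=
  (measurePreserving_snd (μ := stdGaussian ι) (ν := stdGaussian κ)).comp
    (measurePreserving_sumPiEquivProdPi fun _ : ι ⊕ κ => gaussianReal 0 1)

lemma integrable_sqNorm_sub_stdGaussian (u : ι → ℝ) :
    Integrable (fun x => sqNorm (x - u)) (stdGaussian ι) := by
  refine integrable_finsetSum _ fun i _ => ?_
  have h : MemLp (fun t : ℝ => t - u i) 2 (gaussianReal 0 1) :=
    (memLp_id_gaussianReal 2).sub (memLp_const _)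
  exact (h.comp_measurePreserving
    (measurePreserving_eval (fun _ : ι => gaussianReal 0 1) i)).integrable_sq

lemma integrable_sqDistTo {T : Set (ι → ℝ)} (hT : T.Nonempty) :
    Integrable (sqDistTo T) (stdGaussian ι) := by
  obtain ⟨u, hu⟩ := hT
  refine (integrable_sqNorm_sub_stdGaussian u).mono'
    (measurable_sqDistTo T).aestronglyMeasurable (ae_of_all _ fun x => ?_)
  rw [Real.norm_of_nonneg (sqDistTo_nonneg T x)]
  exact sqDistTo_le hu x

end StandardGaussian

lemma integrable_sqrt {Ω : Type*} [MeasurableSpace Ω] {μ : Measure Ω} [IsFiniteMeasure μ]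
    {X : Ω → ℝ} (hX : Integrable X μ) : Integrable (fun ω => √(X ω)) μ := by
  refine (hX.norm.add (integrable_const (1 : ℝ))).mono'
    (Real.continuous_sqrt.comp_aestronglyMeasurable hX.aestronglyMeasurable)
    (ae_of_all _ fun ω => ?_)
  rw [Real.norm_of_nonneg (Real.sqrt_nonneg _)]
  refine Real.sqrt_le_iff.2 ⟨by simp only [Pi.add_apply]; positivity, ?_⟩
  simp only [Pi.add_apply, Real.norm_eq_abs]
  nlinarith [le_abs_self (X ω), abs_nonneg (X ω)]

lemma integral_sqrt_le {Ω : Type*} [MeasurableSpace Ω] {μ : Measure Ω} [IsProbabilityMeasure μ]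
    {X : Ω → ℝ} (hX : Integrable X μ) (h0 : ∀ ω, 0 ≤ X ω) :
    ∫ ω, √(X ω) ∂μ ≤ √(∫ ω, X ω ∂μ) :=
  Real.strictConcaveOn_sqrt.concaveOn.le_map_integral Real.continuous_sqrt.continuousOn
    isClosed_Ici (ae_of_all _ h0) hX (integrable_sqrt hX)

section Subdifferential

variable {ι : Type*} [Fintype ι]

lemma IsNorm.nonneg {f : (ι → ℝ) → ℝ} (hf : IsNorm f) (x : ι → ℝ) : 0 ≤ f x := by
  have h := hf.triangle x ((-1 : ℝ) • x)
  rw [hf.smul] at h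
  have h0 : f (x + (-1 : ℝ) • x) = 0 := (hf.eq_zero_iff _).2 (by simp)
  rw [h0] at h
  norm_num at h
  linarith

lemma IsNorm.subdiff_nonempty {f : (ι → ℝ) → ℝ} (hf : IsNorm f) (x : ι → ℝ) :
    (subdiff f x).Nonempty := by
  classical
  obtain ⟨φ, hφx, hφ⟩ : ∃ φ : (ι → ℝ) →ₗ[ℝ] ℝ, φ x = f x ∧ ∀ y, φ y ≤ f y := by
    by_cases hx : x = 0
    · exact ⟨0, by simp [hx, (hf.eq_zero_iff 0).2 rfl], fun y => by simpa using hf.nonneg y⟩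
    · obtain ⟨φ, h1, h2⟩ := exists_extension_of_le_sublinear
        (LinearPMap.mkSpanSingleton x (f x) hx) f
        (fun c hc y => by rw [hf.smul, abs_of_pos hc]) hf.triangle (by
          rintro ⟨y, hy⟩
          obtain ⟨c, rfl⟩ := Submodule.mem_span_singleton.1 hy
          rw [LinearPMap.mkSpanSingleton'_apply, hf.smul]
          exact mul_le_mul_of_nonneg_right (le_abs_self c) (hf.nonneg x))
      refine ⟨φ, ?_, h2⟩
      rw [h1 ⟨x, Submodule.mem_span_singleton_self x⟩, LinearPMap.mkSpanSingleton_apply]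
  refine ⟨fun i => φ (Pi.single i 1), fun d => ?_⟩
  have hd : dotp (fun i => φ (Pi.single i 1)) d = φ d := by
    conv_rhs => rw [pi_eq_sum_univ' d, map_sum]
    refine Finset.sum_congr rfl fun i _ => ?_
    rw [map_smul, smul_eq_mul, mul_comm]
  rw [hd, ← hφx, ← map_add]
  exact hφ _

end Subdifferential

section Polar

variable {ι κ : Type*} [Fintype ι] [Fintype κ]

/-- A unit vector in the polar of `T₁ × T₂` correlates with `h` by at most the distance of `h`
from `T₁ × T₂`. -/
lemma dotp_le_sqrt_sqDistTo {T₁ : Set (ι → ℝ)} {T₂ : Set (κ → ℝ)} (h₁ : T₁.Nonempty)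
    (h₂ : T₂.Nonempty) {x : ι ⊕ κ → ℝ} (hx : sqNorm x = 1)
    (hpol : ∀ u ∈ T₁, ∀ s ∈ T₂, dotp x (Sum.elim u s) ≤ 0) (h : ι ⊕ κ → ℝ) :
    dotp h x ≤ √(sqDistTo T₁ (fun i => h (Sum.inl i)) + sqDistTo T₂ (fun j => h (Sum.inr j))) := by
  rcases le_total (dotp h x) 0 with hneg | hpos
  · exact hneg.trans (Real.sqrt_nonneg _)
  refine Real.le_sqrt_of_sq_le ?_
  have key : ∀ u ∈ T₁, ∀ s ∈ T₂, dotp h x ^ 2 ≤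
      sqNorm ((fun i => h (Sum.inl i)) - u) + sqNorm ((fun j => h (Sum.inr j)) - s) := by
    intro u hu s hs
    have hsub : dotp (h - Sum.elim u s) x = dotp h x - dotp x (Sum.elim u s) := by
      simp only [dotp, ← Finset.sum_sub_distrib, Pi.sub_apply]
      exact Finset.sum_congr rfl fun i _ => by ring
    have hsplit : sqNorm (h - Sum.elim u s) =
        sqNorm ((fun i => h (Sum.inl i)) - u) + sqNorm ((fun j => h (Sum.inr j)) - s) := by
      simp [sqNorm]
    have hcs := dotp_sq_le (h - Sum.elim u s) x
    rw [hx, mul_one, hsplit] at hcs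
    refine le_trans (pow_le_pow_left₀ hpos ?_ 2) hcs
    linarith [hpol u hu s hs]
  have step : ∀ s ∈ T₂, dotp h x ^ 2 - sqNorm ((fun j => h (Sum.inr j)) - s) ≤
      sqDistTo T₁ (fun i => h (Sum.inl i)) := by
    intro s hs
    refine le_csInf (h₁.image _) ?_
    rintro _ ⟨u, hu, rfl⟩
    linarith [key u hu s hs]
  have : dotp h x ^ 2 - sqDistTo T₁ (fun i => h (Sum.inl i)) ≤
      sqDistTo T₂ (fun j => h (Sum.inr j)) := by
    refine le_csInf (h₂.image _) ?_
    rintro _ ⟨s, hs, rfl⟩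
    linarith [step s hs]
  linarith

/-- Any set of unit vectors in the polar of `T₁ × T₂` has Gaussian complexity at most twice the
root mean square distance of a Gaussian vector from `T₁ × T₂`. -/
lemma gaussComplexity_le_of_polar {T₁ : Set (ι → ℝ)} {T₂ : Set (κ → ℝ)} (h₁ : T₁.Nonempty)
    (h₂ : T₂.Nonempty) {K : Set (ι ⊕ κ → ℝ)} (hK : ∀ x ∈ K, sqNorm x = 1)
    (hpol : ∀ x ∈ K, ∀ u ∈ T₁, ∀ s ∈ T₂, dotp x (Sum.elim u s) ≤ 0) :
    gaussComplexity K ≤ 2 * √(gaussSqDist T₁ + gaussSqDist T₂) := by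
  set S : (ι ⊕ κ → ℝ) → ℝ := fun h =>
    sqDistTo T₁ (fun i => h (Sum.inl i)) + sqDistTo T₂ (fun j => h (Sum.inr j))
  have hS0 : ∀ h, 0 ≤ S h := fun h => add_nonneg (sqDistTo_nonneg _ _) (sqDistTo_nonneg _ _)
  have hi₁ := measurePreserving_inl_stdGaussian (κ := κ) |>.integrable_comp_of_integrable
    (integrable_sqDistTo h₁)
  have hi₂ := measurePreserving_inr_stdGaussian (ι := ι) |>.integrable_comp_of_integrable
    (integrable_sqDistTo h₂)
  have hSi : Integrable S (stdGaussian (ι ⊕ κ)) := hi₁.add hi₂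
  have hSint : ∫ h, S h ∂stdGaussian (ι ⊕ κ) = gaussSqDist T₁ + gaussSqDist T₂ := by
    refine (integral_add hi₁ hi₂).trans ?_
    congr 1
    · simp only [Function.comp_def]
      rw [← integral_map measurePreserving_inl_stdGaussian.aemeasurable
        (measurable_sqDistTo T₁).aestronglyMeasurable,
        measurePreserving_inl_stdGaussian.map_eq]
      rfl
    · simp only [Function.comp_def]
      rw [← integral_map measurePreserving_inr_stdGaussian.aemeasurable
        (measurable_sqDistTo T₂).aestronglyMeasurable,
        measurePreserving_inr_stdGaussian.map_eq]
      rfl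
  have hRi := integrable_sqrt hSi
  have hneg := measurePreserving_neg_stdGaussian (ι := ι ⊕ κ)
  have hRi' : Integrable (fun h => √(S (-h))) (stdGaussian (ι ⊕ κ)) :=
    hneg.integrable_comp_of_integrable hRi
  have hReq : ∫ h, √(S (-h)) ∂stdGaussian (ι ⊕ κ) = ∫ h, √(S h) ∂stdGaussian (ι ⊕ κ) :=
    hneg.integral_comp (MeasurableEquiv.neg (ι ⊕ κ → ℝ)).measurableEmbedding fun h => √(S h)
  calc gaussComplexity K ≤ ∫ h, (√(S h) + √(S (-h))) ∂stdGaussian (ι ⊕ κ) := by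
        refine integral_mono_of_nonneg (ae_of_all _ fun h => Real.sSup_nonneg ?_)
          (hRi.add hRi') (ae_of_all _ fun h => Real.sSup_le ?_ (by positivity))
        · rintro _ ⟨x, -, rfl⟩
          exact abs_nonneg _
        · rintro _ ⟨x, hx, rfl⟩
          have e₁ := dotp_le_sqrt_sqDistTo h₁ h₂ (hK x hx) (hpol x hx) h
          have e₂ := dotp_le_sqrt_sqDistTo h₁ h₂ (hK x hx) (hpol x hx) (-h)
          have e₃ : dotp (-h) x = -dotp h x := by simp [dotp]
          rw [e₃] at e₂
          exact abs_le.2 ⟨by linarith [Real.sqrt_nonneg (S h)],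
            by linarith [Real.sqrt_nonneg (S (-h))]⟩
    _ = 2 * ∫ h, √(S h) ∂stdGaussian (ι ⊕ κ) := by
        rw [integral_add hRi hRi', hReq, two_mul]
    _ ≤ 2 * √(gaussSqDist T₁ + gaussSqDist T₂) := by
        rw [← hSint]
        gcongr
        exact integral_sqrt_le hSi hS0

end Polar

/-- **Gaussian complexity bound for the partially penalized error cone.** -/
theorem gauss_complexity_partially_penalized_cone {n m : ℕ}
    (f : (Fin n → ℝ) → ℝ) (g : (Fin m → ℝ) → ℝ) (hf : IsNorm f) (hg : IsNorm g)
    (xs : Fin n → ℝ) (vs : Fin m → ℝ) (lam l1 l2 : ℝ)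
    (hl1 : 0 < l1) (hl2 : 0 < l2) (hlam : lam = l2 / l1)
    (C₂ : Set ((Fin n → ℝ) × (Fin m → ℝ)))
    (hC₂ : C₂ = {p | ∀ u ∈ subdiff f xs, ∀ s ∈ subdiff g vs,
      dotp p.1 u + lam * dotp p.2 s ≤ 0}) :
    gaussComplexity (sphPair C₂) ≤
      2 * Real.sqrt (gaussSqDist ((fun u => l1 • u) '' subdiff f xs) +
        gaussSqDist ((fun s => l2 • s) '' subdiff g vs)) + 1 := by
  subst hC₂ hlam
  refine (gaussComplexity_le_of_polar ((hf.subdiff_nonempty xs).image _)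
    ((hg.subdiff_nonempty vs).image _) (K := sphPair _) (fun x hx => hx.2) ?_).trans
    (le_add_of_nonneg_right zero_le_one)
  rintro _ ⟨⟨p, hp, rfl⟩, -⟩ _ ⟨u, hu, rfl⟩ _ ⟨s, hs, rfl⟩
  have hdot : dotp (pairVec p) (Sum.elim (l1 • u) (l2 • s)) =
      l1 * (dotp p.1 u + l2 / l1 * dotp p.2 s) := by
    rw [mul_add, ← mul_assoc, mul_div_cancel₀ _ hl1.ne']
    simp [dotp, pairVec, Finset.mul_sum, mul_left_comm]
  rw [hdot]
  exact mul_nonpos_of_nonneg_of_nonpos hl1.le (hp u hu s hs)
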